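/- For every prime p there exists δ = δ(p) > 0 such that for all integers k ≥ 2 and d ≥ k, there is a k-nearly orthogonal set in F_p^d of size at least d^{δ·k/log₂ k}. -/

import Mathlib

open Finset in
/-- Sequences of length `j` in `B` that are pairwise related. -/
noncomputable def relSeq {X : Type*} [Fintype X] (R : X → X → Prop) (j : ℕ) (B : Finset X) :
    Finset (Fin j → X) := by
  classical
  exact Finset.univ.filter (fun f => (∀ i, f i ∈ B) ∧ ∀ i i', i < i' → R (f i) (f i'))

open Classical in
lemma relSeq_succ {X : Type*} [Fintype X] (R : X → X → Prop) (j : ℕ) (B : Finset X) :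
    (relSeq R (j + 1) B).card ≤ ∑ x ∈ B, (relSeq R j (B.filter (R x))).card := by
  have h1 : ∀ f ∈ relSeq R (j + 1) B, f 0 ∈ B := by
    intro f hf
    simp only [relSeq, Finset.mem_filter, Finset.mem_univ, true_and] at hf
    exact hf.1 0
  rw [Finset.card_eq_sum_card_fiberwise h1]
  apply Finset.sum_le_sum
  intro x hx
  apply Finset.card_le_card_of_injOn (fun f => Fin.tail f)
  · intro f hf
    simp only [relSeq, Finset.coe_filter, Finset.mem_filter, Finset.mem_univ, true_and,
      Set.mem_ofPred_eq] at hf ⊢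
    obtain ⟨⟨ha, hb⟩, rfl⟩ := hf
    refine ⟨fun i => ⟨ha _, hb _ _ (Fin.succ_pos i)⟩, fun i i' h => hb _ _ (by simpa using h)⟩
  · intro f hf g hg h
    simp only [Finset.coe_filter, Set.mem_ofPred_eq] at hf hg
    rw [← Fin.cons_self_tail f, ← Fin.cons_self_tail g, hf.2, hg.2]
    simp only at h
    rw [h]

open Classical in
lemma relSeq_bound {X : Type*} [Fintype X] (R : X → X → Prop) (V : Finset X) (N M β : ℝ)
    (hM : 0 < M) (hN : M ≤ N) (hβ : 0 < β) (hV : (V.card : ℝ) ≤ N)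
    (hyp : ∀ B ⊆ V, M < (B.card : ℝ) →
      ((B.filter (fun x => ¬ (((B.filter (R x)).card : ℝ) ≤ β * B.card))).card : ℝ) ≤ M) :
    ∀ (j g : ℕ) (B : Finset X), B ⊆ V → (B.card : ℝ) * β ^ g ≤ M →
      ((relSeq R j B).card : ℝ) ≤ (2 * M) ^ j * (N / M) ^ g := by
  have hNM : 1 ≤ N / M := by rwa [one_le_div hM]
  intro j
  induction j with
  | zero =>
    intro g B hB hg
    have h1 : (relSeq R 0 B).card ≤ 1 := by
      refine (Finset.card_le_univ _).trans ?_
      simp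
    have h2 : (1 : ℝ) ≤ (N / M) ^ g := one_le_pow₀ hNM
    have h3 : ((relSeq R 0 B).card : ℝ) ≤ 1 := by exact_mod_cast h1
    simpa using h3.trans h2
  | succ j ih =>
    intro g B hB hg
    have h0 : ((relSeq R (j + 1) B).card : ℝ) ≤
        ∑ x ∈ B, ((relSeq R j (B.filter (R x))).card : ℝ) := by
      exact_mod_cast relSeq_succ R j B
    have hsame : ∀ x ∈ B, ((relSeq R j (B.filter (R x))).card : ℝ) ≤
        (2 * M) ^ j * (N / M) ^ g := by
      intro x hx
      apply ih g _ ((Finset.filter_subset _ _).trans hB)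
      refine le_trans ?_ hg
      have : ((B.filter (R x)).card : ℝ) ≤ B.card := by
        exact_mod_cast Finset.card_filter_le _ _
      gcongr
    have hpos : 0 ≤ (2 * M) ^ j * (N / M) ^ g := by positivity
    refine h0.trans ?_
    by_cases hBM : (B.card : ℝ) ≤ M
    · calc _ ≤ ∑ x ∈ B, (2 * M) ^ j * (N / M) ^ g := Finset.sum_le_sum hsame
        _ = B.card * ((2 * M) ^ j * (N / M) ^ g) := by simp
        _ ≤ (2 * M) * ((2 * M) ^ j * (N / M) ^ g) := by gcongr; linarith
        _ = _ := by ring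
    · push Not at hBM
      obtain _ | g' := g
      · simp at hg; linarith
      rw [← Finset.sum_filter_add_sum_filter_not B
        (fun x => ¬ (((B.filter (R x)).card : ℝ) ≤ β * B.card))]
      have hA : ∑ x ∈ B with ¬ (((B.filter (R x)).card : ℝ) ≤ β * B.card),
          ((relSeq R j (B.filter (R x))).card : ℝ) ≤ M * ((2 * M) ^ j * (N / M) ^ (g' + 1)) := by
        refine (Finset.sum_le_sum (fun x hx => hsame x (Finset.mem_filter.1 hx).1)).trans ?_
        rw [Finset.sum_const, nsmul_eq_mul]
        exact mul_le_mul_of_nonneg_right (hyp B hB hBM) hpos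
      have hC : ∑ x ∈ B with ¬ ¬ (((B.filter (R x)).card : ℝ) ≤ β * B.card),
          ((relSeq R j (B.filter (R x))).card : ℝ) ≤ N * ((2 * M) ^ j * (N / M) ^ g') := by
        have : ∀ x ∈ B.filter (fun x => ¬ ¬ (((B.filter (R x)).card : ℝ) ≤ β * B.card)),
            ((relSeq R j (B.filter (R x))).card : ℝ) ≤ (2 * M) ^ j * (N / M) ^ g' := by
          intro x hx
          rw [Finset.mem_filter, not_not] at hx
          apply ih g' _ ((Finset.filter_subset _ _).trans hB)
          calc _ ≤ (β * B.card) * β ^ g' := by gcongr; exact hx.2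
            _ = B.card * β ^ (g' + 1) := by ring
            _ ≤ M := hg
        refine (Finset.sum_le_sum this).trans ?_
        rw [Finset.sum_const, nsmul_eq_mul]
        refine mul_le_mul_of_nonneg_right ?_ (by positivity)
        refine le_trans ?_ hV
        exact_mod_cast Finset.card_le_card ((Finset.filter_subset _ _).trans hB)
      refine (add_le_add hA hC).trans (le_of_eq ?_)
      have hNq : N = N / M * M := by field_simp
      generalize N / M = q at hNq ⊢
      rw [hNq]
      ring

lemma exists_good_map {Y : Type*} [Fintype Y] [Nonempty Y] (K n : ℕ)
    (E : Finset (Fin K → Y)) (h : n ^ K * E.card < Fintype.card Y ^ K) :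
    ∃ f : Fin n → Y, ∀ e : Fin K ↪ Fin n, f ∘ e ∉ E := by
  classical
  by_contra hcon
  push Not at hcon
  have key : ∀ e : Fin K ↪ Fin n,
      (Finset.univ.filter (fun f : Fin n → Y => f ∘ e ∈ E)).card * Fintype.card Y ^ K ≤
        E.card * Fintype.card Y ^ n := by
    intro e
    have h1 : ((Finset.univ.filter (fun f : Fin n → Y => f ∘ e ∈ E)) ×ˢ
        (Finset.univ : Finset (Fin K → Y))).card ≤
        (E ×ˢ (Finset.univ : Finset (Fin n → Y))).card := by
      apply Finset.card_le_card_of_injOn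
        (fun q => (q.1 ∘ e, Function.extend e q.2 q.1))
      · intro q hq
        simp at hq ⊢
        exact hq
      · rintro ⟨f, a⟩ hq ⟨f', a'⟩ hq' heq
        simp only [Prod.mk.injEq] at heq
        obtain ⟨h1, h2⟩ := heq
        have ha : a = a' := by
          funext i
          have := congrFun h2 (e i)
          rwa [e.injective.extend_apply, e.injective.extend_apply] at this
        have hf : f = f' := by
          funext i
          by_cases hi : ∃ l, e l = i
          · obtain ⟨l, rfl⟩ := hi
            exact congrFun h1 l
          · have := congrFun h2 i
            rwa [Function.extend_apply' _ _ _ hi, Function.extend_apply' _ _ _ hi] at this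
        rw [ha, hf]
    simpa [Finset.card_product] using h1
  have hcover : (Finset.univ : Finset (Fin n → Y)) ⊆
      (Finset.univ : Finset (Fin K ↪ Fin n)).biUnion
        (fun e => Finset.univ.filter (fun f : Fin n → Y => f ∘ e ∈ E)) := by
    intro f _
    obtain ⟨e, he⟩ := hcon f
    simp only [Finset.mem_biUnion, Finset.mem_filter, Finset.mem_univ, true_and]
    exact ⟨e, he⟩
  have h2 := (Finset.card_le_card hcover).trans Finset.card_biUnion_le
  have h3 : Fintype.card Y ^ n * Fintype.card Y ^ K ≤ n ^ K * (E.card * Fintype.card Y ^ n) := by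
    calc _ ≤ (∑ e : Fin K ↪ Fin n,
          (Finset.univ.filter (fun f : Fin n → Y => f ∘ e ∈ E)).card) * Fintype.card Y ^ K := by
          apply Nat.mul_le_mul_right
          simpa using h2
      _ = ∑ e : Fin K ↪ Fin n,
          (Finset.univ.filter (fun f : Fin n → Y => f ∘ e ∈ E)).card * Fintype.card Y ^ K := by
          rw [Finset.sum_mul]
      _ ≤ ∑ e : Fin K ↪ Fin n, E.card * Fintype.card Y ^ n := Finset.sum_le_sum fun e _ => key e
      _ = Fintype.card (Fin K ↪ Fin n) * (E.card * Fintype.card Y ^ n) := by simp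
      _ ≤ _ := by
          apply Nat.mul_le_mul_right
          have := Fintype.card_le_of_injective (fun e : Fin K ↪ Fin n => (e : Fin K → Fin n))
            DFunLike.coe_injective
          simpa using this
  have hYpos : 0 < Fintype.card Y ^ n := pow_pos Fintype.card_pos _
  have h4 : Fintype.card Y ^ K ≤ n ^ K * E.card := by
    apply Nat.le_of_mul_le_mul_left _ hYpos
    linarith [h3, mul_comm (Fintype.card Y ^ n) (n ^ K * E.card),
      mul_assoc (n ^ K) E.card (Fintype.card Y ^ n)]
  omega

section SecondMoment

variable {p : ℕ} [Fact p.Prime]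

/-- Balanced indicator of zero. -/
def balInd (p : ℕ) (a : ZMod p) : ℝ := if a = 0 then (p : ℝ) - 1 else -1

lemma sum_balInd : ∑ a : ZMod p, balInd p a = 0 := by
  have : ∀ a : ZMod p, balInd p a = (if a = 0 then (p : ℝ) else 0) - 1 := by
    intro a; unfold balInd; split_ifs <;> simp
  simp [this, ZMod.card]

lemma abs_balInd_le (a : ZMod p) : |balInd p a| ≤ p := by
  have h1 : (1 : ℝ) ≤ p := by exact_mod_cast (Fact.out : p.Prime).one_le
  unfold balInd
  split_ifs
  · rw [abs_le]; constructor <;> linarith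
  · simpa using h1

lemma pair_sum_zero {t : ℕ} (b b' y : Fin t → ZMod p) (h1 : y ⬝ᵥ b = 0) (h2 : y ⬝ᵥ b' ≠ 0) :
    ∑ x : Fin t → ZMod p, balInd p (x ⬝ᵥ b) * balInd p (x ⬝ᵥ b') = 0 := by
  have hp0 : (p : ℝ) ≠ 0 := by exact_mod_cast (Fact.out : p.Prime).ne_zero
  have hinv : ∀ c : ZMod p, ∑ x : Fin t → ZMod p, balInd p (x ⬝ᵥ b) * balInd p (x ⬝ᵥ b') =
      ∑ x : Fin t → ZMod p, balInd p (x ⬝ᵥ b) * balInd p (x ⬝ᵥ b' + c * (y ⬝ᵥ b')) := by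
    intro c
    rw [← Equiv.sum_comp (Equiv.addRight (c • y))]
    apply Finset.sum_congr rfl
    intro x _
    simp [add_dotProduct, smul_dotProduct, h1]
  have hs : ∀ s : ZMod p, ∑ c : ZMod p, balInd p (s + c * (y ⬝ᵥ b')) = 0 := by
    intro s
    rw [← sum_balInd (p := p)]
    exact ((Equiv.mulRight₀ _ h2).trans (Equiv.addLeft s)).sum_comp (balInd p)
  have h3 : ∑ c : ZMod p, ∑ x : Fin t → ZMod p, balInd p (x ⬝ᵥ b) * balInd p (x ⬝ᵥ b') = 0 := by
    rw [Finset.sum_congr rfl (fun c _ => hinv c), Finset.sum_comm]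
    apply Finset.sum_eq_zero
    intro x _
    rw [← Finset.mul_sum, hs, mul_zero]
  rw [Finset.sum_const, Finset.card_univ, ZMod.card, nsmul_eq_mul] at h3
  exact (mul_eq_zero.1 h3).resolve_left hp0

lemma exists_sep {t : ℕ} (b b' : Fin t → ZMod p) (hb : b ≠ 0) (h : ∀ c : ZMod p, b' ≠ c • b) :
    ∃ y : Fin t → ZMod p, y ⬝ᵥ b = 0 ∧ y ⬝ᵥ b' ≠ 0 := by
  obtain ⟨i, hi⟩ := Function.ne_iff.1 hb
  obtain ⟨j, hj⟩ := Function.ne_iff.1 (h (b' i / b i))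
  simp only [Pi.zero_apply] at hi
  refine ⟨Pi.single j (b i) - Pi.single i (b j), ?_, ?_⟩
  · simp [sub_dotProduct, single_dotProduct]; ring
  · simp only [sub_dotProduct, single_dotProduct]
    intro h0
    apply hj
    simp only [Pi.smul_apply, smul_eq_mul]
    field_simp
    linear_combination h0

open Classical in
lemma second_moment {t : ℕ} (B : Finset (Fin t → ZMod p)) (hB : ∀ b ∈ B, b ≠ 0) :
    ∑ x : Fin t → ZMod p, (∑ b ∈ B, balInd p (x ⬝ᵥ b)) ^ 2 ≤
      (p : ℝ) ^ t * (p : ℝ) ^ 3 * B.card := by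
  have h1 : ∑ x : Fin t → ZMod p, (∑ b ∈ B, balInd p (x ⬝ᵥ b)) ^ 2 =
      ∑ b ∈ B, ∑ b' ∈ B, ∑ x : Fin t → ZMod p, balInd p (x ⬝ᵥ b) * balInd p (x ⬝ᵥ b') := by
    simp_rw [sq, Finset.sum_mul_sum]
    rw [Finset.sum_comm]
    apply Finset.sum_congr rfl
    intro b _
    rw [Finset.sum_comm]
  have hone : ∀ b b' : Fin t → ZMod p,
      ∑ x : Fin t → ZMod p, balInd p (x ⬝ᵥ b) * balInd p (x ⬝ᵥ b') ≤ (p : ℝ) ^ t * (p : ℝ) ^ 2 := by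
    intro b b'
    have : ∀ x : Fin t → ZMod p, balInd p (x ⬝ᵥ b) * balInd p (x ⬝ᵥ b') ≤ (p : ℝ) ^ 2 := by
      intro x
      refine (le_abs_self _).trans ?_
      rw [abs_mul, sq]
      exact mul_le_mul (abs_balInd_le _) (abs_balInd_le _) (abs_nonneg _) (by positivity)
    refine (Finset.sum_le_sum (fun x _ => this x)).trans (le_of_eq ?_)
    simp [ZMod.card]
  rw [h1]
  have hrow : ∀ b ∈ B, ∑ b' ∈ B, ∑ x : Fin t → ZMod p,
      balInd p (x ⬝ᵥ b) * balInd p (x ⬝ᵥ b') ≤ (p : ℝ) ^ t * (p : ℝ) ^ 3 := by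
    intro b hb
    have hz : ∑ b' ∈ B with (∃ c : ZMod p, b' = c • b), ∑ x : Fin t → ZMod p,
        balInd p (x ⬝ᵥ b) * balInd p (x ⬝ᵥ b') = ∑ b' ∈ B, ∑ x : Fin t → ZMod p,
        balInd p (x ⬝ᵥ b) * balInd p (x ⬝ᵥ b') := by
      apply Finset.sum_filter_of_ne
      intro b' _ hne
      by_contra hcon
      push Not at hcon
      obtain ⟨y, hy1, hy2⟩ := exists_sep b b' (hB b hb) hcon
      exact hne (pair_sum_zero b b' y hy1 hy2)
    rw [← hz]
    refine (Finset.sum_le_sum (fun b' _ => hone b b')).trans ?_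
    rw [Finset.sum_const, nsmul_eq_mul]
    have hc : (B.filter (fun b' => ∃ c : ZMod p, b' = c • b)).card ≤ p := by
      calc _ ≤ ((Finset.univ : Finset (ZMod p)).image (fun c => c • b)).card := by
            apply Finset.card_le_card
            intro b' hb'
            obtain ⟨_, c, rfl⟩ := Finset.mem_filter.1 hb'
            exact Finset.mem_image_of_mem _ (Finset.mem_univ c)
        _ ≤ _ := Finset.card_image_le
        _ = p := by simp [ZMod.card]
    have hc' : ((B.filter (fun b' => ∃ c : ZMod p, b' = c • b)).card : ℝ) ≤ p := by exact_mod_cast hc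
    calc _ ≤ (p : ℝ) * ((p : ℝ) ^ t * (p : ℝ) ^ 2) := by gcongr
      _ = _ := by ring
  refine (Finset.sum_le_sum hrow).trans (le_of_eq ?_)
  rw [Finset.sum_const, nsmul_eq_mul]; ring

open Classical in
lemma few_bad {t : ℕ} (B : Finset (Fin t → ZMod p)) (hB : ∀ b ∈ B, b ≠ 0) (M : ℝ) (hM : 0 < M)
    (hMt : 4 * (p : ℝ) ^ t * (p : ℝ) ^ 3 ≤ M ^ 2) (hBM : M < (B.card : ℝ)) :
    ((B.filter (fun x => ¬ (((B.filter (fun y => x ⬝ᵥ y ≠ 0)).card : ℝ) ≤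
      (1 - 1 / (2 * p)) * B.card))).card : ℝ) ≤ M := by
  have hp0 : (0 : ℝ) < p := by exact_mod_cast (Fact.out : p.Prime).pos
  have hval : ∀ x : Fin t → ZMod p, ∑ b ∈ B, balInd p (x ⬝ᵥ b) =
      p * B.card - p * (B.filter (fun y => x ⬝ᵥ y ≠ 0)).card - B.card := by
    intro x
    have : ∀ a : ZMod p, balInd p a = (p : ℝ) - p * (if a ≠ 0 then 1 else 0) - 1 := by
      intro a; unfold balInd; split_ifs <;> simp_all
    simp only [this, Finset.sum_sub_distrib, Finset.sum_const, nsmul_eq_mul, ← Finset.mul_sum,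
      Finset.sum_boole]
    ring
  set D := B.filter (fun x => ¬ (((B.filter (fun y => x ⬝ᵥ y ≠ 0)).card : ℝ) ≤
      (1 - 1 / (2 * p)) * B.card)) with hD
  have hDx : ∀ x ∈ D, (B.card : ℝ) ^ 2 / 4 ≤ (∑ b ∈ B, balInd p (x ⬝ᵥ b)) ^ 2 := by
    intro x hx
    have h1 := (Finset.mem_filter.1 hx).2
    push Not at h1
    rw [hval]
    have h2 : p * ((1 - 1 / (2 * p)) * (B.card : ℝ)) <
        p * ((B.filter (fun y => x ⬝ᵥ y ≠ 0)).card : ℝ) := mul_lt_mul_of_pos_left h1 hp0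
    have h3 : p * ((1 - 1 / (2 * p)) * (B.card : ℝ)) = p * B.card - B.card / 2 := by
      field_simp
    rw [h3] at h2
    have h4 : (0 : ℝ) ≤ B.card := by positivity
    nlinarith
  have h5 : (D.card : ℝ) * ((B.card : ℝ) ^ 2 / 4) ≤ (p : ℝ) ^ t * (p : ℝ) ^ 3 * B.card := by
    refine le_trans ?_ (second_moment B hB)
    calc _ = ∑ x ∈ D, (B.card : ℝ) ^ 2 / 4 := by simp
      _ ≤ ∑ x ∈ D, (∑ b ∈ B, balInd p (x ⬝ᵥ b)) ^ 2 := Finset.sum_le_sum hDx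
      _ ≤ _ := Finset.sum_le_sum_of_subset_of_nonneg (Finset.subset_univ _)
        (fun _ _ _ => sq_nonneg _)
  have hBpos : (0 : ℝ) < B.card := hM.trans hBM
  have h6 : (D.card : ℝ) * B.card ≤ M ^ 2 := by
    have : (D.card : ℝ) * B.card * B.card ≤ M ^ 2 * B.card := by nlinarith
    exact le_of_mul_le_mul_right this hBpos
  by_contra hcon
  push Not at hcon
  nlinarith

/-- non-self-orthogonal vectors -/
def nso (p t : ℕ) [Fact p.Prime] : Finset (Fin t → ZMod p) :=
  Finset.univ.filter (fun x => x ⬝ᵥ x ≠ 0)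

lemma nso_card (t : ℕ) : p ^ t ≤ (nso p (t + 1)).card := by
  have : (Finset.univ : Finset (Fin t → ZMod p)).card = p ^ t := by simp [ZMod.card]
  rw [← this]
  apply Finset.card_le_card_of_injOn
    (fun w => (Fin.cons (if w ⬝ᵥ w = 0 then 1 else 0) w : Fin (t + 1) → ZMod p))
  · intro w _
    simp only [nso, Finset.coe_filter, Finset.mem_univ, true_and, Set.mem_ofPred_eq]
    by_cases h : w ⬝ᵥ w = 0
    · rw [if_pos h]
      simp only [dotProduct, Fin.sum_univ_succ, Fin.cons_zero, Fin.cons_succ] at h ⊢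
      simp [h]
    · rw [if_neg h]
      simp only [dotProduct, Fin.sum_univ_succ, Fin.cons_zero, Fin.cons_succ] at h ⊢
      simpa using h
  · intro w _ w' _ h
    exact (Fin.cons_inj.1 h).2

lemma relSeq_nso (C s K : ℕ) (hC : (1 - 1 / (2 * p) : ℝ) ^ C ≤ 1 / p) (hs : 3 ≤ s) :
    (relSeq (fun x y : Fin (2 * s) → ZMod p => x ⬝ᵥ y ≠ 0) K (nso p (2 * s))).card ≤
      p ^ ((s + 4) * K + C * s * s) := by
  classical
  have hp2 : (2 : ℝ) ≤ p := by exact_mod_cast (Fact.out : p.Prime).two_le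
  have hp1 : (1 : ℝ) ≤ p := by linarith
  have hβ : (0 : ℝ) < 1 - 1 / (2 * p) := by
    have : (1 : ℝ) / (2 * p) < 1 := by rw [div_lt_one (by linarith)]; linarith
    linarith
  have hVN : ((nso p (2 * s)).card : ℝ) ≤ (p : ℝ) ^ (2 * s) := by
    have := Finset.card_le_univ (nso p (2 * s))
    simp only [Fintype.card_pi, ZMod.card, Finset.prod_const, Finset.card_univ,
      Fintype.card_fin] at this
    exact_mod_cast this
  have h := relSeq_bound (fun x y : Fin (2 * s) → ZMod p => x ⬝ᵥ y ≠ 0) (nso p (2 * s))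
    ((p : ℝ) ^ (2 * s)) ((p : ℝ) ^ (s + 3)) (1 - 1 / (2 * p)) (by positivity)
    (pow_le_pow_right₀ hp1 (by omega)) hβ hVN ?_ K (C * s) (nso p (2 * s)) subset_rfl ?_
  · have h2 : (2 * (p : ℝ) ^ (s + 3)) ^ K * ((p : ℝ) ^ (2 * s) / (p : ℝ) ^ (s + 3)) ^ (C * s) ≤
        (p : ℝ) ^ ((s + 4) * K + C * s * s) := by
      have e1 : 2 * (p : ℝ) ^ (s + 3) ≤ (p : ℝ) ^ (s + 4) := by
        rw [pow_succ (p : ℝ) (s + 3), mul_comm]; gcongr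
      have e2 : (p : ℝ) ^ (2 * s) / (p : ℝ) ^ (s + 3) ≤ (p : ℝ) ^ s := by
        rw [div_le_iff₀ (by positivity), ← pow_add]
        exact pow_le_pow_right₀ hp1 (by omega)
      calc _ ≤ ((p : ℝ) ^ (s + 4)) ^ K * ((p : ℝ) ^ s) ^ (C * s) := by gcongr
        _ = _ := by rw [← pow_mul, ← pow_mul, ← pow_add]; congr 1; ring
    exact_mod_cast h.trans h2
  · intro B hB hBM
    have hfb := few_bad B ?_ ((p : ℝ) ^ (s + 3)) (by positivity) ?_ hBM
    · convert hfb
    · intro b hb h0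
      have := hB hb
      simp [nso, h0] at this
    · have : (4 : ℝ) ≤ p ^ 2 := by nlinarith
      calc 4 * (p : ℝ) ^ (2 * s) * (p : ℝ) ^ 3 ≤ (p : ℝ) ^ 2 * (p : ℝ) ^ (2 * s) * (p : ℝ) ^ 3 := by
            gcongr
        _ = (p : ℝ) ^ (2 * s + 5) := by ring
        _ ≤ (p : ℝ) ^ (2 * s + 6) := pow_le_pow_right₀ hp1 (by omega)
        _ = _ := by ring
  · calc _ ≤ (p : ℝ) ^ (2 * s) * (1 / p) ^ s := by
          rw [pow_mul]
          gcongr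
      _ = (p : ℝ) ^ s := by
          rw [two_mul, pow_add, mul_assoc, ← mul_pow, mul_one_div_cancel (by positivity)]; simp
      _ ≤ _ := pow_le_pow_right₀ hp1 (by omega)

/-- Tensor product placed in `Fin d` through an embedding. -/
noncomputable def tens {t m d : ℕ} (ι : (Fin m → Fin t) ↪ Fin d) (x : Fin m → Fin t → ZMod p) :
    Fin d → ZMod p :=
  Function.extend ι (fun a => ∏ c, x c (a c)) 0

lemma tens_dot {t m d : ℕ} (ι : (Fin m → Fin t) ↪ Fin d) (x y : Fin m → Fin t → ZMod p) :
    ∑ i, tens ι x i * tens ι y i = ∏ c, x c ⬝ᵥ y c := by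
  classical
  have h1 : ∑ i, tens ι x i * tens ι y i = ∑ a, tens ι x (ι a) * tens ι y (ι a) := by
    rw [← Finset.sum_map Finset.univ ι (fun i => tens ι x i * tens ι y i)]
    symm
    apply Finset.sum_subset (Finset.subset_univ _)
    intro i _ hi
    have : ¬ ∃ a, ι a = i := by simpa using hi
    simp [tens, Function.extend_apply' _ _ _ this]
  rw [h1]
  simp only [tens, ι.injective.extend_apply, dotProduct, ← Finset.prod_mul_distrib]
  rw [Finset.prod_univ_sum]
  simp

lemma main_construct (C r m k d : ℕ) (hC : (1 - 1 / (2 * p) : ℝ) ^ C ≤ 1 / p)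
    (hr : 5 ≤ r) (hm : 1 ≤ m) (hk : 16 * C * r ≤ k) (hk2 : k < 2 ^ r) (hk0 : 0 < k)
    (hd : (8 * r) ^ m ≤ d) :
    ∃ A : Finset (Fin d → ZMod p), p ^ (r * m) ≤ A.card ∧
      (∀ v ∈ A, ∑ i, v i * v i ≠ 0) ∧
          (∀ S ⊆ A, S.card = k + 1 →
            ∃ u ∈ S, ∃ v ∈ S, u ≠ v ∧ ∑ i, u i * v i = 0) := by
  classical
  have hpp : p.Prime := Fact.out
  have hp2 := hpp.two_le
  obtain ⟨ι⟩ : Nonempty ((Fin m → Fin (2 * (4 * r))) ↪ Fin d) := by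
    apply Function.Embedding.nonempty_of_card_le
    simp only [Fintype.card_pi, Fintype.card_fin, Finset.prod_const, Finset.card_univ]
    refine le_trans (le_of_eq ?_) hd
    congr 1; ring
  set V := nso p (2 * (4 * r)) with hV
  have hVc : p ^ (8 * r - 1) ≤ V.card := by
    have := nso_card (p := p) (8 * r - 1)
    have e : 8 * r - 1 + 1 = 2 * (4 * r) := by omega
    rw [e] at this
    exact this
  have hVne : V.Nonempty := by
    rw [← Finset.card_pos]
    exact lt_of_lt_of_le (pow_pos hpp.pos _) hVc
  have : Nonempty V := hVne.to_subtype
  set W := relSeq (fun x y : Fin (2 * (4 * r)) → ZMod p => x ⬝ᵥ y ≠ 0) (k + 1) V with hW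
  have hWc := relSeq_nso (p := p) C (4 * r) (k + 1) hC (by omega)
  let E : Finset (Fin (k + 1) → (Fin m → V)) := Finset.univ.filter
    (fun f => ∀ i j, i < j → ∀ c, (f i c : Fin (2 * (4 * r)) → ZMod p) ⬝ᵥ (f j c) ≠ 0)
  have hE : E.card ≤ W.card ^ m := by
    have : (Fintype.piFinset (fun _ : Fin m => W)).card = W.card ^ m := by simp
    rw [← this]
    apply Finset.card_le_card_of_injOn (fun f c i => (f i c : Fin (2 * (4 * r)) → ZMod p))
    · intro f hf
      have hf' := (Finset.mem_filter.1 hf).2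
      simp only [Finset.mem_coe, Fintype.mem_piFinset]
      intro c
      simp only [hW, relSeq, Finset.mem_filter, Finset.mem_univ, true_and]
      exact ⟨fun i => (f i c).2, fun i j hij => hf' i j hij c⟩
    · intro f _ g _ h
      funext i c
      exact Subtype.ext (congrFun (congrFun h c) i)
  have hlt : (k * p ^ (r * m)) ^ (k + 1) * E.card < Fintype.card (Fin m → V) ^ (k + 1) := by
    have hYc : Fintype.card (Fin m → V) = V.card ^ m := by simp
    rw [hYc]
    have hkp : k < p ^ (r * m) := by
      calc k < 2 ^ r := hk2
        _ ≤ p ^ r := Nat.pow_le_pow_left hp2 r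
        _ ≤ p ^ (r * m) := Nat.pow_le_pow_right hpp.pos (Nat.le_mul_of_pos_right r hm)
    have a1 : (k * p ^ (r * m)) ^ (k + 1) < (p ^ (2 * r * m)) ^ (k + 1) := by
      apply Nat.pow_lt_pow_left _ (by omega)
      calc k * p ^ (r * m) < p ^ (r * m) * p ^ (r * m) :=
            Nat.mul_lt_mul_of_pos_right hkp (pow_pos hpp.pos _)
        _ = _ := by rw [← pow_add]; congr 1; ring
    have a2 : E.card ≤ (p ^ ((4 * r + 4) * (k + 1) + C * (4 * r) * (4 * r))) ^ m :=
      hE.trans (Nat.pow_le_pow_left hWc m)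
    calc _ < (p ^ (2 * r * m)) ^ (k + 1) *
          (p ^ ((4 * r + 4) * (k + 1) + C * (4 * r) * (4 * r))) ^ m := by
          refine lt_of_le_of_lt (Nat.mul_le_mul_left _ a2) ?_
          exact Nat.mul_lt_mul_of_pos_right a1 (pow_pos (pow_pos hpp.pos _) _)
      _ = p ^ (m * (2 * r * (k + 1) + ((4 * r + 4) * (k + 1) + C * (4 * r) * (4 * r)))) := by
          rw [← pow_mul, ← pow_mul, ← pow_add]; congr 1; ring
      _ ≤ p ^ (m * ((8 * r - 1) * (k + 1))) := by
          apply Nat.pow_le_pow_right hpp.pos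
          apply Nat.mul_le_mul_left
          obtain ⟨q, rfl⟩ := Nat.exists_eq_add_of_le hr
          have : 8 * (5 + q) - 1 = 39 + 8 * q := by omega
          rw [this]
          nlinarith [Nat.mul_le_mul_right (5 + q) hk]
      _ = ((p ^ (8 * r - 1)) ^ m) ^ (k + 1) := by
          rw [← pow_mul, ← pow_mul]; congr 1; ring
      _ ≤ _ := by gcongr
  obtain ⟨f, hf⟩ := exists_good_map (k + 1) (k * p ^ (r * m)) E hlt
  let g : Fin (k * p ^ (r * m)) → (Fin d → ZMod p) :=
    fun i => tens ι (fun c => (f i c : Fin (2 * (4 * r)) → ZMod p))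
  have hg : ∀ i j, ∑ l, g i l * g j l =
      ∏ c, (f i c : Fin (2 * (4 * r)) → ZMod p) ⬝ᵥ (f j c) := fun i j => tens_dot ι _ _
  have hself : ∀ i, ∑ l, g i l * g i l ≠ 0 := by
    intro i
    rw [hg, Finset.prod_ne_zero_iff]
    intro c _
    have := (f i c).2
    simp only [hV, nso, Finset.mem_filter] at this
    exact this.2
  have hex : ∀ e : Fin (k + 1) ↪ Fin (k * p ^ (r * m)), ∃ i j, i < j ∧
      ∑ l, g (e i) l * g (e j) l = 0 := by
    intro e
    have := hf e
    simp only [E, Finset.mem_filter, Finset.mem_univ, true_and] at this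
    push Not at this
    obtain ⟨i, j, hij, c, hc⟩ := this
    refine ⟨i, j, hij, ?_⟩
    rw [hg]
    exact Finset.prod_eq_zero (Finset.mem_univ c) hc
  refine ⟨Finset.univ.image g, ?_, ?_, ?_⟩
  · have hfib : ∀ v ∈ Finset.univ.image g, (Finset.univ.filter (fun i => g i = v)).card ≤ k := by
      intro v _
      by_contra hcon
      push Not at hcon
      obtain ⟨T, hT, hTc⟩ := Finset.exists_subset_card_eq (Nat.succ_le_of_lt hcon)
      let e := (T.orderEmbOfFin hTc).toEmbedding
      obtain ⟨i, j, hij, h0⟩ := hex e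
      have he : ∀ i, g (e i) = v := fun i =>
        (Finset.mem_filter.1 (hT (T.orderEmbOfFin_mem hTc i))).2
      have := hself (e i)
      rw [he i] at this h0
      rw [he j] at h0
      exact this h0
    have := Finset.card_le_mul_card_image (Finset.univ : Finset (Fin (k * p ^ (r * m)))) k hfib
    simp only [Finset.card_univ, Fintype.card_fin] at this
    exact Nat.le_of_mul_le_mul_left this hk0
  · intro v hv
    obtain ⟨i, _, rfl⟩ := Finset.mem_image.1 hv
    exact hself i
  · intro S hS hSc
    have hch : ∀ v : S, ∃ i, g i = v := by
      intro v
      obtain ⟨i, _, h⟩ := Finset.mem_image.1 (hS v.2)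
      exact ⟨i, h⟩
    choose σ hσ using hch
    let q : Fin (k + 1) ≃ S := (Fintype.equivFinOfCardEq (by simpa using hSc)).symm
    have hinj : Function.Injective (fun i => σ (q i)) := by
      intro i j h
      apply q.injective
      apply Subtype.ext
      rw [← hσ, ← hσ]
      exact congrArg g h
    obtain ⟨i, j, hij, h0⟩ := hex ⟨_, hinj⟩
    simp only [Function.Embedding.coeFn_mk, hσ] at h0
    refine ⟨q i, (q i).2, q j, (q j).2, ?_, h0⟩
    intro h
    exact hij.ne (q.injective (Subtype.ext h))

end SecondMoment

/-- For every prime `p` there exists `δ = δ(p) > 0` such that for all integers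
`k ≥ 2` and `d ≥ k`, there is a `k`-nearly orthogonal set in `F_p^d` of size at
least `d^(δ·k/log₂ k)`. -/
theorem stmt_19 (p : ℕ) (hp : p.Prime) :
    ∃ δ : ℝ, 0 < δ ∧
      ∀ k d : ℕ, 2 ≤ k → k ≤ d →
        ∃ A : Finset (Fin d → ZMod p),
          (d : ℝ) ^ (δ * k / Real.logb 2 k) ≤ (A.card : ℝ) ∧
          (∀ v ∈ A, ∑ i, v i * v i ≠ 0) ∧
          (∀ S ⊆ A, S.card = k + 1 →
            ∃ u ∈ S, ∃ v ∈ S, u ≠ v ∧ ∑ i, u i * v i = 0) := by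
  classical
  have : Fact p.Prime := ⟨hp⟩
  have hp2 : (2 : ℝ) ≤ p := by exact_mod_cast hp.two_le
  have hinvp : (1 : ℝ) / (2 * p) < 1 := by rw [div_lt_one (by linarith)]; linarith
  have hinvp0 : (0 : ℝ) < 1 / (2 * p) := by positivity
  obtain ⟨C, hC⟩ : ∃ C : ℕ, (1 - 1 / (2 * p) : ℝ) ^ C ≤ 1 / p := by
    obtain ⟨C, hC⟩ := exists_pow_lt_of_lt_one (show (0 : ℝ) < 1 / p by positivity)
      (show (1 - 1 / (2 * p) : ℝ) < 1 by linarith)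
    exact ⟨C, hC.le⟩
  have hC1 : 1 ≤ C := by
    rcases Nat.eq_zero_or_pos C with rfl | h
    · rw [pow_zero, le_div_iff₀ (by linarith)] at hC; linarith
    · exact h
  obtain ⟨r0, hr0⟩ : ∃ r0 : ℕ, ∀ r, r0 ≤ r → 32 * C * r < 2 ^ r := by
    have h := tendsto_pow_const_mul_const_pow_of_abs_lt_one 1
      (show |(1 / 2 : ℝ)| < 1 by rw [abs_of_pos] <;> norm_num)
    have h2 := h.eventually (gt_mem_nhds (show (0 : ℝ) < 1 / (32 * C) by positivity))
    obtain ⟨r0, h3⟩ := Filter.eventually_atTop.1 h2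
    refine ⟨r0, fun r hr => ?_⟩
    have h4 := h3 r hr
    rw [pow_one, one_div, inv_pow, ← div_eq_mul_inv, div_lt_div_iff₀ (by positivity)
      (by positivity)] at h4
    have h5 : (32 * C * r : ℝ) < 2 ^ r := by linarith
    exact_mod_cast h5
  set ρ := max r0 5 with hρ
  have hρ5 : 5 ≤ ρ := le_max_right _ _
  have hCR : (1 : ℝ) ≤ C := by exact_mod_cast hC1
  have hρR : (5 : ℝ) ≤ ρ := by exact_mod_cast hρ5
  refine ⟨1 / (64 * C * ρ), by positivity, ?_⟩
  intro k d hk hd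
  have hkR : (2 : ℝ) ≤ k := by exact_mod_cast hk
  have hdR : (2 : ℝ) ≤ d := by exact_mod_cast hk.trans hd
  have hlog1 : 1 ≤ Real.logb 2 k := by
    rw [Real.le_logb_iff_rpow_le (by norm_num) (by linarith)]; simpa using hkR
  rcases lt_or_ge k (16 * C * ρ) with hsmall | hbig
  · -- standard basis
    have hsR : (k : ℝ) < 16 * C * ρ := by exact_mod_cast hsmall
    have hinj : Function.Injective (fun i : Fin d => (Pi.single i 1 : Fin d → ZMod p)) :=
      fun i j h => by
        have := congrFun h i
        by_contra hne
        simp [Pi.single_apply, hne] at this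
    refine ⟨Finset.univ.image (fun i : Fin d => (Pi.single i 1 : Fin d → ZMod p)), ?_, ?_, ?_⟩
    · rw [Finset.card_image_of_injective _ hinj, Finset.card_univ, Fintype.card_fin]
      calc _ ≤ (d : ℝ) ^ (1 : ℝ) := by
            apply Real.rpow_le_rpow_of_exponent_le (by linarith)
            rw [div_le_one (by linarith), one_div_mul_eq_div]
            refine le_trans ?_ hlog1
            rw [div_le_one (by positivity)]
            nlinarith
        _ = d := Real.rpow_one _
    · intro v hv
      obtain ⟨i, _, rfl⟩ := Finset.mem_image.1 hv
      simp [Pi.single_apply]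
    · intro S hS hSc
      obtain ⟨u, hu, v, hv, huv⟩ := Finset.one_lt_card.1 (show 1 < S.card by omega)
      refine ⟨u, hu, v, hv, huv, ?_⟩
      obtain ⟨i, _, rfl⟩ := Finset.mem_image.1 (hS hu)
      obtain ⟨j, _, rfl⟩ := Finset.mem_image.1 (hS hv)
      have hij : i ≠ j := fun h => huv (by rw [h])
      simp [Pi.single_apply, hij.symm]
  · set r := k / (16 * C) with hrdef
    have hCpos : 0 < 16 * C := by omega
    have hrρ : ρ ≤ r := by
      rw [hrdef, Nat.le_div_iff_mul_le hCpos]; linarith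
    have hr5 : 5 ≤ r := hρ5.trans hrρ
    have hk1 : 16 * C * r ≤ k := Nat.mul_div_le k (16 * C)
    have hk2 : k < 32 * C * r := by
      have := Nat.lt_mul_div_succ k hCpos
      rw [← hrdef] at this
      nlinarith
    have hk3 : k < 2 ^ r := hk2.trans (hr0 r ((le_max_left _ _).trans hrρ))
    have ht : 8 * r ≤ k := by nlinarith
    set m := Nat.log (8 * r) d with hm
    have ht1 : 1 < 8 * r := by omega
    have hm1 : 1 ≤ m := Nat.log_pos ht1 (ht.trans hd)
    obtain ⟨A, hA, hA1, hA2⟩ := main_construct (p := p) C r m k d hC hr5 hm1 hk1 hk3 (by omega)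
      (Nat.pow_log_le_self _ (by omega))
    refine ⟨A, ?_, hA1, hA2⟩
    have hdk : d ≤ k ^ (2 * m) := by
      calc d ≤ (8 * r) ^ (m + 1) := (Nat.lt_pow_succ_log_self ht1 d).le
        _ ≤ k ^ (m + 1) := Nat.pow_le_pow_left ht _
        _ ≤ k ^ (2 * m) := Nat.pow_le_pow_right (by omega) (by omega)
    have hdkR : (d : ℝ) ≤ (k : ℝ) ^ ((2 * m : ℕ) : ℝ) := by
      rw [Real.rpow_natCast]; exact_mod_cast hdk
    have hAR : (p : ℝ) ^ (r * m) ≤ A.card := by exact_mod_cast hA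
    refine le_trans ?_ hAR
    have hk2R : (k : ℝ) < 32 * C * r := by exact_mod_cast hk2
    have hkk : (k : ℝ) = (2 : ℝ) ^ Real.logb 2 k :=
      (Real.rpow_logb (by norm_num) (by norm_num) (by linarith)).symm
    have hexp : 0 ≤ 1 / (64 * C * ρ) * (k : ℝ) / Real.logb 2 k := by positivity
    calc (d : ℝ) ^ (1 / (64 * C * ρ) * (k : ℝ) / Real.logb 2 k)
        ≤ ((k : ℝ) ^ ((2 * m : ℕ) : ℝ)) ^ (1 / (64 * C * ρ) * (k : ℝ) / Real.logb 2 k) :=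
          Real.rpow_le_rpow (by linarith) hdkR hexp
      _ = (2 : ℝ) ^ (Real.logb 2 k * (((2 * m : ℕ) : ℝ) *
            (1 / (64 * C * ρ) * (k : ℝ) / Real.logb 2 k))) := by
          rw [← Real.rpow_mul (by linarith), Real.rpow_mul (by norm_num : (0 : ℝ) ≤ 2)
            (Real.logb 2 k), ← hkk]
      _ ≤ (2 : ℝ) ^ ((r * m : ℕ) : ℝ) := by
          apply Real.rpow_le_rpow_of_exponent_le (by norm_num)
          have : Real.logb 2 k * (((2 * m : ℕ) : ℝ) *
            (1 / (64 * C * ρ) * (k : ℝ) / Real.logb 2 k)) = m * (k / (32 * C * ρ)) := by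
            have : Real.logb 2 k ≠ 0 := by linarith
            push_cast
            field_simp
            ring
          rw [this, mul_comm]
          push_cast
          gcongr
          rw [div_le_iff₀ (by positivity)]
          have : (0 : ℝ) ≤ 32 * C * r := by positivity
          nlinarith
      _ = (2 : ℝ) ^ (r * m) := Real.rpow_natCast _ _
      _ ≤ _ := by gcongr
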